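/- For all i, j ∈ I, the operators on U⁺ satisfy ∂_i ∘ ∂_j' = r^{⟨α_j,α_i⟩} s^{−⟨α_i,α_j⟩} ∂_j' ∘ ∂_i. -/

import Mathlib

noncomputable section

/-- The q-integer `(m)_v = 1 + v + ⋯ + v^{m-1}`. -/
def qnat {K : Type} [CommRing K] (v : K) (m : ℕ) : K := ∑ i ∈ Finset.range m, v ^ i

/-- The Gaussian binomial coefficient `binom(m,k)_v`, as a polynomial expression in `v`
(defined through the Pascal-type recurrence). -/
def qbinom {K : Type} [CommRing K] (v : K) : ℕ → ℕ → K
  | _, 0 => 1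
  | 0, _ + 1 => 0
  | m + 1, k + 1 => qbinom v m k + v ^ (k + 1) * qbinom v m (k + 1)

/-- The Euler (Ringel) form on basis elements: `⟨α_i, α_j⟩ = d_i a_{ij}` if `i < j`,
`d_i` if `i = j`, and `0` if `i > j`. -/
def eulB {n : ℕ} (a : Fin n → Fin n → ℤ) (d : Fin n → ℤ) (i j : Fin n) : ℤ :=
  if i < j then d i * a i j else if i = j then d i else 0

/-- The Euler form on the root lattice `Q = Fin n → ℤ` (coordinates in the basis `α_i`). -/
def euler {n : ℕ} (a : Fin n → Fin n → ℤ) (d : Fin n → ℤ) (μ ν : Fin n → ℤ) : ℤ :=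
  ∑ i, ∑ j, μ i * ν j * eulB a d i j

/-- The coefficient `c^{(k)}_{ij} = (r_i s_i⁻¹)^{k(k-1)/2} r^{k⟨α_j,α_i⟩} s^{-k⟨α_i,α_j⟩}`. -/
def ccoef {K : Type} [Field K] {n : ℕ} (a : Fin n → Fin n → ℤ) (d : Fin n → ℤ)
    (r s : K) (i j : Fin n) (k : ℕ) : K :=
  (r ^ d i * (s ^ d i)⁻¹) ^ (k * (k - 1) / 2) *
    r ^ ((k : ℤ) * eulB a d j i) * (s ^ ((k : ℤ) * eulB a d i j))⁻¹

/-- The `(r,s)`-Serre element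
`∑_{k=0}^{1-a_{ij}} (-1)^k binom(1-a_{ij},k)_{r_i s_i⁻¹} c^{(k)}_{ij} E_i^{1-a_{ij}-k} E_j E_i^k`. -/
def serreElt {K : Type} [Field K] {n : ℕ} (a : Fin n → Fin n → ℤ) (d : Fin n → ℤ)
    (r s : K) {A : Type} [Ring A] [Algebra K A] (E : Fin n → A) (i j : Fin n) : A :=
  ∑ k ∈ Finset.range ((1 - a i j).toNat + 1),
    ((-1 : K) ^ k * qbinom (r ^ d i * (s ^ d i)⁻¹) ((1 - a i j).toNat) k *
        ccoef a d r s i j k) •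
      (E i ^ ((1 - a i j).toNat - k) * E j * E i ^ k)

/-- The defining relations of `U⁺_{r,s}`: the `(r,s)`-Serre relations. -/
inductive SerreRel (K : Type) [Field K] {n : ℕ} (a : Fin n → Fin n → ℤ) (d : Fin n → ℤ)
    (r s : K) : FreeAlgebra K (Fin n) → FreeAlgebra K (Fin n) → Prop
  | rel (i j : Fin n) (h : i ≠ j) :
      SerreRel K a d r s (serreElt a d r s (FreeAlgebra.ι K) i j) 0

/-- `U⁺_{r,s}`: the algebra generated by the `e_i` subject only to the `(r,s)`-Serre
relations. -/
abbrev Uplus (K : Type) [Field K] {n : ℕ} (a : Fin n → Fin n → ℤ) (d : Fin n → ℤ)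
    (r s : K) : Type := RingQuot (SerreRel K a d r s)

/-- The generator `e_i` of `U⁺_{r,s}`. -/
def eP (K : Type) [Field K] {n : ℕ} (a : Fin n → Fin n → ℤ) (d : Fin n → ℤ)
    (r s : K) (i : Fin n) : Uplus K a d r s :=
  RingQuot.mkAlgHom K (SerreRel K a d r s) (FreeAlgebra.ι K i)

/-- The degree-`μ` homogeneous component of `U⁺_{r,s}` for `μ ∈ Q⁺`: the span of the
monomials in the `e_i` in which `e_i` occurs exactly `μ i` times. -/
def UplusDeg (K : Type) [Field K] {n : ℕ} (a : Fin n → Fin n → ℤ) (d : Fin n → ℤ)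
    (r s : K) (μ : Fin n → ℕ) : Submodule K (Uplus K a d r s) :=
  Submodule.span K
    {x | ∃ w : List (Fin n), (∀ i, w.count i = μ i) ∧ x = (w.map (eP K a d r s)).prod}


/-- The `(r,s)`-Serre element for the negative generators:
`∑_{k=0}^{1-a_{ij}} (-1)^k binom(1-a_{ij},k)_{r_i s_i⁻¹} c^{(k)}_{ij} F_i^k F_j F_i^{1-a_{ij}-k}`. -/
def serreEltF {K : Type} [Field K] {n : ℕ} (a : Fin n → Fin n → ℤ) (d : Fin n → ℤ)
    (r s : K) {A : Type} [Ring A] [Algebra K A] (F : Fin n → A) (i j : Fin n) : A :=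
  ∑ k ∈ Finset.range ((1 - a i j).toNat + 1),
    ((-1 : K) ^ k * qbinom (r ^ d i * (s ^ d i)⁻¹) ((1 - a i j).toNat) k *
        ccoef a d r s i j k) •
      (F i ^ k * F j * F i ^ ((1 - a i j).toNat - k))

/-- The field `ℚ(r,s)` of rational functions in two variables over `ℚ`. -/
abbrev K2 : Type := FractionRing (MvPolynomial (Fin 2) ℚ)

/-- The parameter `r ∈ ℚ(r,s)`. -/
def rr : K2 := algebraMap (MvPolynomial (Fin 2) ℚ) K2 (MvPolynomial.X 0)

/-- The parameter `s ∈ ℚ(r,s)`. -/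
def ss : K2 := algebraMap (MvPolynomial (Fin 2) ℚ) K2 (MvPolynomial.X 1)

/-- Generators of the two-parameter quantum group `U_{r,s}(𝔤)`:
`e_i, f_i, ω_i^{±1}, ω_i'^{±1}`. -/
inductive Gen (n : ℕ) : Type
  | e (i : Fin n) : Gen n
  | f (i : Fin n) : Gen n
  | w (i : Fin n) : Gen n
  | winv (i : Fin n) : Gen n
  | w' (i : Fin n) : Gen n
  | w'inv (i : Fin n) : Gen n

/-- The four toral generators `ω_i, ω_i^{-1}, ω_i', ω_i'^{-1}` attached to `i`. -/
def tor {n : ℕ} (i : Fin n) : Bool → Bool → Gen n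
  | false, false => Gen.w i
  | false, true => Gen.winv i
  | true, false => Gen.w' i
  | true, true => Gen.w'inv i

/-- The defining relations (R1)–(R6) of the two-parameter quantum group `U_{r,s}(𝔤)`. -/
inductive URel {n : ℕ} (a : Fin n → Fin n → ℤ) (d : Fin n → ℤ) :
    FreeAlgebra K2 (Gen n) → FreeAlgebra K2 (Gen n) → Prop
  | torComm (i j : Fin n) (p q p' q' : Bool) :
      URel a d (FreeAlgebra.ι K2 (tor i p q) * FreeAlgebra.ι K2 (tor j p' q'))
        (FreeAlgebra.ι K2 (tor j p' q') * FreeAlgebra.ι K2 (tor i p q))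
  | wInvR (i : Fin n) :
      URel a d (FreeAlgebra.ι K2 (Gen.w i) * FreeAlgebra.ι K2 (Gen.winv i)) 1
  | wInvL (i : Fin n) :
      URel a d (FreeAlgebra.ι K2 (Gen.winv i) * FreeAlgebra.ι K2 (Gen.w i)) 1
  | w'InvR (i : Fin n) :
      URel a d (FreeAlgebra.ι K2 (Gen.w' i) * FreeAlgebra.ι K2 (Gen.w'inv i)) 1
  | w'InvL (i : Fin n) :
      URel a d (FreeAlgebra.ι K2 (Gen.w'inv i) * FreeAlgebra.ι K2 (Gen.w' i)) 1
  | we (i j : Fin n) :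
      URel a d (FreeAlgebra.ι K2 (Gen.w i) * FreeAlgebra.ι K2 (Gen.e j))
        ((rr ^ eulB a d j i * (ss ^ eulB a d i j)⁻¹) •
          (FreeAlgebra.ι K2 (Gen.e j) * FreeAlgebra.ι K2 (Gen.w i)))
  | w'e (i j : Fin n) :
      URel a d (FreeAlgebra.ι K2 (Gen.w' i) * FreeAlgebra.ι K2 (Gen.e j))
        (((rr ^ eulB a d i j)⁻¹ * ss ^ eulB a d j i) •
          (FreeAlgebra.ι K2 (Gen.e j) * FreeAlgebra.ι K2 (Gen.w' i)))
  | wf (i j : Fin n) :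
      URel a d (FreeAlgebra.ι K2 (Gen.w i) * FreeAlgebra.ι K2 (Gen.f j))
        (((rr ^ eulB a d j i)⁻¹ * ss ^ eulB a d i j) •
          (FreeAlgebra.ι K2 (Gen.f j) * FreeAlgebra.ι K2 (Gen.w i)))
  | w'f (i j : Fin n) :
      URel a d (FreeAlgebra.ι K2 (Gen.w' i) * FreeAlgebra.ι K2 (Gen.f j))
        ((rr ^ eulB a d i j * (ss ^ eulB a d j i)⁻¹) •
          (FreeAlgebra.ι K2 (Gen.f j) * FreeAlgebra.ι K2 (Gen.w' i)))
  | ef (i j : Fin n) :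
      URel a d
        (FreeAlgebra.ι K2 (Gen.e i) * FreeAlgebra.ι K2 (Gen.f j) -
          FreeAlgebra.ι K2 (Gen.f j) * FreeAlgebra.ι K2 (Gen.e i))
        (if i = j then
          ((rr ^ d i - ss ^ d i)⁻¹) •
            (FreeAlgebra.ι K2 (Gen.w i) - FreeAlgebra.ι K2 (Gen.w' i))
         else 0)
  | serreE (i j : Fin n) (h : i ≠ j) :
      URel a d (serreElt a d rr ss (fun k => FreeAlgebra.ι K2 (Gen.e k)) i j) 0
  | serreF (i j : Fin n) (h : i ≠ j) :
      URel a d (serreEltF a d rr ss (fun k => FreeAlgebra.ι K2 (Gen.f k)) i j) 0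

/-- The two-parameter quantum group `U_{r,s}(𝔤)` over `ℚ(r,s)`. -/
abbrev Uq {n : ℕ} (a : Fin n → Fin n → ℤ) (d : Fin n → ℤ) : Type :=
  RingQuot (URel a d)

/-- The image of a generator in `U_{r,s}(𝔤)`. -/
def gU {n : ℕ} (a : Fin n → Fin n → ℤ) (d : Fin n → ℤ) (x : Gen n) : Uq a d :=
  RingQuot.mkAlgHom K2 (URel a d) (FreeAlgebra.ι K2 x)

/-- The subalgebra `U⁺` of `U_{r,s}(𝔤)` generated by the `e_i`. -/
def Upos {n : ℕ} (a : Fin n → Fin n → ℤ) (d : Fin n → ℤ) : Subalgebra K2 (Uq a d) :=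
  Algebra.adjoin K2 (Set.range fun i => gU a d (Gen.e i))

/-- The subalgebra `U⁻` of `U_{r,s}(𝔤)` generated by the `f_i`. -/
def Uneg {n : ℕ} (a : Fin n → Fin n → ℤ) (d : Fin n → ℤ) : Subalgebra K2 (Uq a d) :=
  Algebra.adjoin K2 (Set.range fun i => gU a d (Gen.f i))

/-- The subalgebra `U⁰` of `U_{r,s}(𝔤)` generated by the `ω_i^{±1}, ω_i'^{±1}`. -/
def Uzero {n : ℕ} (a : Fin n → Fin n → ℤ) (d : Fin n → ℤ) : Subalgebra K2 (Uq a d) :=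
  Algebra.adjoin K2 (Set.range fun p : Fin n × Bool × Bool => gU a d (tor p.1 p.2.1 p.2.2))

/-- The generator `e_i` of `U⁺ ⊆ U_{r,s}(𝔤)`, as an element of the subalgebra `U⁺`. -/
def eUp {n : ℕ} (a : Fin n → Fin n → ℤ) (d : Fin n → ℤ) (i : Fin n) : ↥(Upos a d) :=
  ⟨gU a d (Gen.e i), Algebra.subset_adjoin (Set.mem_range_self i)⟩

section QSerre

variable {K : Type} [Field K] {B : Type} [Ring B] [Algebra K B]

/-- The iterated `v`-commutator: `qad v z x y (m + 1) = x X - v ^ m z X x` with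
`X = qad v z x y m`. -/
def qad (v z : K) (x y : B) : ℕ → B
  | 0 => y
  | m + 1 => x * qad v z x y m - (v ^ m * z) • (qad v z x y m * x)

theorem qad_succ' (v z : K) (x y : B) (m : ℕ) :
    qad v z x y (m + 1) = x * qad v (v * z) x y m - z • (qad v (v * z) x y m * x) := by
  induction m with
  | zero => simp [qad]
  | succ m ih =>
    rw [qad, ih, qad]
    simp only [mul_sub, sub_mul, mul_smul_comm, smul_mul_assoc, smul_sub, smul_smul, mul_assoc]
    match_scalars <;> ring

theorem qbinom_eq_zero_of_lt (v : K) (m k : ℕ) (h : m < k) : qbinom v m k = 0 := by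
  induction m generalizing k with
  | zero => cases k with
    | zero => omega
    | succ k => rfl
  | succ m ih => cases k with
    | zero => omega
    | succ k => rw [qbinom, ih k (by omega), ih (k + 1) (by omega)]; simp

theorem triangle_succ (k : ℕ) : (k + 1) * (k + 1 - 1) / 2 = k * (k - 1) / 2 + k := by
  have h := Finset.sum_range_succ (fun i => i) k
  rwa [Finset.sum_range_id, Finset.sum_range_id] at h

/-- The coefficient of `x ^ (m - k) * y * x ^ k` in `qad v z x y m`. -/
def qadCoef (v z : K) (m k : ℕ) : K :=
  (-1) ^ k * qbinom v m k * (v ^ (k * (k - 1) / 2) * z ^ k)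

theorem qadCoef_zero (v z : K) (m : ℕ) : qadCoef v z m 0 = 1 := by
  cases m <;> simp [qadCoef, qbinom]

theorem qadCoef_succ (v z : K) (m k : ℕ) :
    qadCoef v z (m + 1) (k + 1) = qadCoef v (v * z) m (k + 1) - z * qadCoef v (v * z) m k := by
  simp only [qadCoef, qbinom, triangle_succ]
  ring

/-- The quantum binomial expansion of an iterated `v`-commutator. -/
theorem sum_qadCoef_eq_qad (v z : K) (x y : B) (m : ℕ) :
    ∑ k ∈ Finset.range (m + 1), qadCoef v z m k • (x ^ (m - k) * y * x ^ k) = qad v z x y m := by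
  induction m generalizing z with
  | zero => simp [qad, qadCoef_zero]
  | succ m ih =>
    rw [qad_succ', ← ih, Finset.sum_range_succ', Finset.mul_sum, Finset.sum_mul, Finset.smul_sum]
    have h1 : ∑ k ∈ Finset.range (m + 1), x * (qadCoef v (v * z) m k • (x ^ (m - k) * y * x ^ k)) =
        ∑ k ∈ Finset.range (m + 1 + 1),
          qadCoef v (v * z) m k • (x ^ (m + 1 - k) * y * x ^ k) := by
      rw [Finset.sum_range_succ _ (m + 1)]
      rw [show qadCoef v (v * z) m (m + 1) = 0 by
        simp [qadCoef, qbinom_eq_zero_of_lt v m (m + 1) (by omega)], zero_smul, add_zero]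
      refine Finset.sum_congr rfl fun k hk => ?_
      rw [Finset.mem_range] at hk
      rw [mul_smul_comm, show m + 1 - k = (m - k) + 1 by omega, pow_succ' x (m - k)]
      simp only [mul_assoc]
    rw [h1, Finset.sum_range_succ' _ (m + 1), qadCoef_zero, qadCoef_zero, add_sub_right_comm,
      ← Finset.sum_sub_distrib]
    congr 1
    refine Finset.sum_congr rfl fun k _ => ?_
    rw [qadCoef_succ, sub_smul, smul_mul_assoc, smul_smul, pow_succ x k,
      show m + 1 - (k + 1) = m - k by omega]
    simp only [mul_assoc]

end QSerre

section Weights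

variable {K : Type} [Field K] {n : ℕ}

/-- The scalar `r^{⟨α_j,α_i⟩} s^{-⟨α_i,α_j⟩}` by which `ω_i` acts on `e_j`. -/
def wt (a : Fin n → Fin n → ℤ) (d : Fin n → ℤ) (r s : K) (i j : Fin n) : K :=
  r ^ eulB a d j i * (s ^ eulB a d i j)⁻¹

variable {a : Fin n → Fin n → ℤ} {d : Fin n → ℤ} {r s : K}

theorem wt_ne_zero (hr : r ≠ 0) (hs : s ≠ 0) (i j : Fin n) : wt a d r s i j ≠ 0 :=
  mul_ne_zero (zpow_ne_zero _ hr) (inv_ne_zero (zpow_ne_zero _ hs))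

theorem wt_self (i : Fin n) : wt a d r s i i = r ^ d i * (s ^ d i)⁻¹ := by
  simp [wt, eulB]

theorem wt_inv (i j : Fin n) :
    (wt a d r s j i)⁻¹ = (r ^ eulB a d i j)⁻¹ * s ^ eulB a d j i := by
  simp [wt, mul_comm]

theorem eulB_add_eulB (hsym : ∀ i j, d i * a i j = d j * a j i) {i j : Fin n} (h : i ≠ j) :
    eulB a d i j + eulB a d j i = d i * a i j := by
  rcases lt_or_gt_of_ne h with h' | h'
  · simp [eulB, h', h'.ne', h'.not_gt]
  · simp [eulB, h', h'.ne', h'.not_gt, hsym i j]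

theorem wt_mul_wt (hr : r ≠ 0) (hs : s ≠ 0) (hsym : ∀ i j, d i * a i j = d j * a j i)
    {i j : Fin n} (h : i ≠ j) :
    wt a d r s i j * wt a d r s j i = wt a d r s i i ^ a i j := by
  have e := eulB_add_eulB hsym h
  rw [wt_self, mul_zpow, inv_zpow, ← zpow_mul, ← zpow_mul, ← e, wt, wt, zpow_add₀ hr, zpow_add₀ hs]
  rw [mul_inv]
  ring

/-- The vanishing condition making the quantum Serre element primitive. -/
theorem exists_wt_pow_mul_eq_one (hr : r ≠ 0) (hs : s ≠ 0) (hoff : ∀ i j, i ≠ j → a i j ≤ 0)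
    (hsym : ∀ i j, d i * a i j = d j * a j i) {i j : Fin n} (h : i ≠ j) :
    ∃ m, (1 - a i j).toNat = m + 1 ∧
      wt a d r s i i ^ m * (wt a d r s i j * wt a d r s j i) = 1 := by
  have h0 := hoff i j h
  refine ⟨(-a i j).toNat, by omega, ?_⟩
  rw [wt_mul_wt hr hs hsym h, ← zpow_natCast, ← zpow_add₀ (wt_ne_zero hr hs i i),
    show (((-a i j).toNat : ℕ) : ℤ) + a i j = 0 by omega, zpow_zero]

variable {B C : Type} [Ring B] [Algebra K B] [Ring C] [Algebra K C]

theorem ccoef_eq (i j : Fin n) (k : ℕ) :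
    ccoef a d r s i j k = wt a d r s i i ^ (k * (k - 1) / 2) * wt a d r s i j ^ k := by
  rw [ccoef, wt_self, wt, mul_pow (r ^ eulB a d j i), inv_pow _ k, mul_comm (k : ℤ),
    mul_comm (k : ℤ), zpow_mul, zpow_mul, zpow_natCast, zpow_natCast, mul_assoc]

theorem serreElt_eq_qad (E : Fin n → B) (i j : Fin n) :
    serreElt a d r s E i j =
      qad (wt a d r s i i) (wt a d r s i j) (E i) (E j) (1 - a i j).toNat := by
  rw [← sum_qadCoef_eq_qad, serreElt]
  simp only [ccoef_eq, qadCoef, wt_self]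

theorem map_serreElt (φ : B →ₐ[K] C) (E : Fin n → B) (i j : Fin n) :
    φ (serreElt a d r s E i j) = serreElt a d r s (fun k => φ (E k)) i j := by
  simp [serreElt]

theorem map_serreEltF (φ : B →ₐ[K] C) (F : Fin n → B) (i j : Fin n) :
    φ (serreEltF a d r s F i j) = serreEltF a d r s (fun k => φ (F k)) i j := by
  simp [serreEltF]

theorem op_serreEltF (F : Fin n → B) (i j : Fin n) :
    MulOpposite.op (serreEltF a d r s F i j) =
      serreElt a d r s (fun k => MulOpposite.op (F k)) i j := by
  simp [serreElt, serreEltF, mul_assoc]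

theorem serreElt_smul (t : Fin n → K) (E : Fin n → B) (i j : Fin n) :
    serreElt a d r s (fun k => t k • E k) i j =
      (t i ^ (1 - a i j).toNat * t j) • serreElt a d r s E i j := by
  rw [serreElt, serreElt, Finset.smul_sum]
  refine Finset.sum_congr rfl fun k hk => ?_
  rw [Finset.mem_range] at hk
  simp only [smul_pow, smul_mul_assoc, mul_smul_comm, smul_smul]
  congr 1
  rw [show t i ^ (1 - a i j).toNat = t i ^ ((1 - a i j).toNat - k) * t i ^ k by
    rw [← pow_add]; congr 1; omega]
  ring

end Weights

/-- The defining relations of a quantum double that link the Cartan part with the generators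
`E_i` and `F_i`, without any Serre relation. -/
structure DoubleRels {K : Type} [Field K] {n : ℕ} {B : Type} [Ring B] [Algebra K B]
    (p : Fin n → Fin n → K) (δ : Fin n → K) (E F W W' : Fin n → B) : Prop where
  we : ∀ i j, W i * E j = p i j • (E j * W i)
  w'e : ∀ i j, W' i * E j = (p j i)⁻¹ • (E j * W' i)
  wf : ∀ i j, W i * F j = (p i j)⁻¹ • (F j * W i)
  w'f : ∀ i j, W' i * F j = p j i • (F j * W' i)
  ef : ∀ i j, E i * F j - F j * E i = if i = j then (δ i)⁻¹ • (W i - W' i) else 0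

namespace DoubleRels

variable {K : Type} [Field K] {n : ℕ} {B C : Type} [Ring B] [Algebra K B] [Ring C] [Algebra K C]
  {p : Fin n → Fin n → K} {δ : Fin n → K} {E F W W' : Fin n → B}

theorem map (h : DoubleRels p δ E F W W') (φ : B →ₐ[K] C) :
    DoubleRels p δ (fun i => φ (E i)) (fun i => φ (F i)) (fun i => φ (W i))
      (fun i => φ (W' i)) where
  we i j := by rw [← map_mul, h.we, map_smul, map_mul]
  w'e i j := by rw [← map_mul, h.w'e, map_smul, map_mul]
  wf i j := by rw [← map_mul, h.wf, map_smul, map_mul]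
  w'f i j := by rw [← map_mul, h.w'f, map_smul, map_mul]
  ef i j := by
    rw [← map_mul, ← map_mul, ← map_sub, h.ef]
    split_ifs <;> simp

/-- Exchanging the `E_i` and the `F_i` preserves the relations in the opposite algebra. -/
theorem op (hp : ∀ i j, p i j ≠ 0) (h : DoubleRels p δ E F W W') :
    DoubleRels p δ (fun i => MulOpposite.op (F i)) (fun i => MulOpposite.op (E i))
      (fun i => MulOpposite.op (W i)) (fun i => MulOpposite.op (W' i)) where
  we i j := by
    rw [← MulOpposite.op_mul, ← MulOpposite.op_mul, h.wf, ← MulOpposite.op_smul, smul_smul,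
      mul_inv_cancel₀ (hp i j), one_smul]
  w'e i j := by
    rw [← MulOpposite.op_mul, ← MulOpposite.op_mul, h.w'f, ← MulOpposite.op_smul, smul_smul,
      inv_mul_cancel₀ (hp j i), one_smul]
  wf i j := by
    rw [← MulOpposite.op_mul, ← MulOpposite.op_mul, h.we, ← MulOpposite.op_smul, smul_smul,
      inv_mul_cancel₀ (hp i j), one_smul]
  w'f i j := by
    rw [← MulOpposite.op_mul, ← MulOpposite.op_mul, h.w'e, ← MulOpposite.op_smul, smul_smul,
      mul_inv_cancel₀ (hp j i), one_smul]
  ef i j := by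
    rw [← MulOpposite.op_mul, ← MulOpposite.op_mul, ← MulOpposite.op_sub, h.ef]
    by_cases hij : i = j
    · subst hij; simp
    · simp [hij, Ne.symm hij]

theorem w_mul_qad (h : DoubleRels p δ E F W W') (i j : Fin n) (m : ℕ) :
    W i * qad (p i i) (p i j) (E i) (E j) m =
      (p i i ^ m * p i j) • (qad (p i i) (p i j) (E i) (E j) m * W i) := by
  induction m with
  | zero => simp [qad, h.we]
  | succ m ih =>
    rw [qad, mul_sub, ← mul_assoc, h.we, mul_smul_comm, ← mul_assoc (W i), ih, smul_mul_assoc,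
      mul_assoc, ih, smul_mul_assoc, mul_assoc _ (W i), h.we]
    simp only [sub_mul, mul_smul_comm, smul_mul_assoc, smul_sub, smul_smul, mul_assoc]
    congr 2 <;> ring

theorem w'_mul_qad (hp : ∀ i j, p i j ≠ 0) (h : DoubleRels p δ E F W W') (i j : Fin n) (m : ℕ) :
    qad (p i i) (p i j) (E i) (E j) m * W' i =
      (p i i ^ m * p j i) • (W' i * qad (p i i) (p i j) (E i) (E j) m) := by
  have hE : ∀ k, E k * W' i = p k i • (W' i * E k) := fun k => by
    rw [h.w'e, smul_smul, mul_inv_cancel₀ (hp k i), one_smul]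
  induction m with
  | zero => simp [qad, hE]
  | succ m ih =>
    rw [qad, sub_mul, mul_assoc, ih, mul_smul_comm, ← mul_assoc (E i), hE, smul_mul_assoc,
      smul_mul_assoc, mul_assoc _ (E i) (W' i), hE, mul_smul_comm, ← mul_assoc _ (W' i), ih]
    simp only [mul_sub, mul_smul_comm, smul_mul_assoc, smul_sub, smul_smul, mul_assoc]
    congr 2 <;> ring

theorem qad_comm_f_self (hp : ∀ i j, p i j ≠ 0) (h : DoubleRels p δ E F W W') {i j : Fin n}
    (hij : i ≠ j) (m : ℕ) :
    qad (p i i) (p i j) (E i) (E j) (m + 1) * F i - F i * qad (p i i) (p i j) (E i) (E j) (m + 1) =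
      (-(δ i)⁻¹ * qnat (p i i) (m + 1) * (1 - p i i ^ m * (p i j * p j i))) •
        (W' i * qad (p i i) (p i j) (E i) (E j) m) := by
  have hE : E i * W' i = p i i • (W' i * E i) := by
    rw [h.w'e, smul_smul, mul_inv_cancel₀ (hp i i), one_smul]
  have hEF := h.ef i i
  rw [if_pos rfl] at hEF
  have step : ∀ m, qad (p i i) (p i j) (E i) (E j) (m + 1) * F i -
      F i * qad (p i i) (p i j) (E i) (E j) (m + 1) =
      (-(δ i)⁻¹ * (1 - p i i ^ (2 * m) * (p i j * p j i))) •
        (W' i * qad (p i i) (p i j) (E i) (E j) m) +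
      (E i * (qad (p i i) (p i j) (E i) (E j) m * F i -
          F i * qad (p i i) (p i j) (E i) (E j) m) -
        (p i i ^ m * p i j) • ((qad (p i i) (p i j) (E i) (E j) m * F i -
          F i * qad (p i i) (p i j) (E i) (E j) m) * E i)) := by
    intro m
    have hW := h.w_mul_qad i j m
    have hW' := h.w'_mul_qad hp i j m
    rw [qad]
    generalize qad (p i i) (p i j) (E i) (E j) m = X at hW hW' ⊢
    have e : (E i * X - (p i i ^ m * p i j) • (X * E i)) * F i -
        F i * (E i * X - (p i i ^ m * p i j) • (X * E i)) =
        ((E i * F i - F i * E i) * X -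
          (p i i ^ m * p i j) • (X * (E i * F i - F i * E i))) +
        (E i * (X * F i - F i * X) - (p i i ^ m * p i j) • ((X * F i - F i * X) * E i)) := by
      simp only [mul_sub, sub_mul, smul_sub, smul_mul_assoc, mul_smul_comm, mul_assoc]
      abel
    rw [e, hEF]
    congr 1
    rw [mul_smul_comm, smul_mul_assoc, mul_sub, sub_mul, hW, hW']
    module
  induction m with
  | zero =>
    rw [step 0]
    have h0 := h.ef j i
    rw [if_neg hij.symm] at h0
    simp [qad, h0, qnat]
  | succ m ih =>
    rw [step (m + 1), ih, smul_mul_assoc, mul_smul_comm, ← mul_assoc (E i) (W' i), hE]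
    have hX : qad (p i i) (p i j) (E i) (E j) (m + 1) =
      E i * qad (p i i) (p i j) (E i) (E j) m -
        (p i i ^ m * p i j) • (qad (p i i) (p i j) (E i) (E j) m * E i) := rfl
    have hq1 : qnat (p i i) (m + 1 + 1) = 1 + p i i * qnat (p i i) (m + 1) := by
      simp only [qnat]
      rw [Finset.sum_range_succ', Finset.mul_sum]
      simp [pow_succ', add_comm]
    have hq2 : (p i i - 1) * qnat (p i i) (m + 1) = p i i ^ (m + 1) - 1 := mul_geom_sum _ _
    rw [hX]
    generalize qad (p i i) (p i j) (E i) (E j) m = X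
    generalize qnat (p i i) (m + 1) = q at hq1 hq2 ⊢
    rw [hq1]
    simp only [mul_sub, smul_sub, mul_smul_comm, smul_mul_assoc, smul_smul, mul_assoc]
    have key : -(δ i)⁻¹ * (1 - p i i ^ (2 * (m + 1)) * (p i j * p j i)) +
        -(δ i)⁻¹ * q * (1 - p i i ^ m * (p i j * p j i)) * p i i =
        -(δ i)⁻¹ * (1 + p i i * q) * (1 - p i i ^ (m + 1) * (p i j * p j i)) := by
      linear_combination (-(δ i)⁻¹ * p i i ^ (m + 1) * (p i j * p j i)) * hq2
    match_scalars
    · linear_combination key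
    · linear_combination (-(p i i ^ m * p i j)) * key

theorem qad_comm_f_right (hp : ∀ i j, p i j ≠ 0) (h : DoubleRels p δ E F W W') {i j : Fin n}
    (hij : i ≠ j) (m : ℕ) :
    ∃ κ : K, qad (p i i) (p i j) (E i) (E j) (m + 1) * F j -
        F j * qad (p i i) (p i j) (E i) (E j) (m + 1) =
      (κ * (1 - p i i ^ m * (p i j * p j i))) • (W j * E i ^ (m + 1)) := by
  have hEF := h.ef j j
  rw [if_pos rfl] at hEF
  have hE : E i * W j = (p j i)⁻¹ • (W j * E i) := by
    rw [h.we, smul_smul, inv_mul_cancel₀ (hp j i), one_smul]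
  have hE' : E i * W' j = p i j • (W' j * E i) := by
    rw [h.w'e, smul_smul, mul_inv_cancel₀ (hp i j), one_smul]
  have h0 := h.ef i j
  rw [if_neg hij, sub_eq_zero] at h0
  have step : ∀ m, qad (p i i) (p i j) (E i) (E j) (m + 1) * F j -
      F j * qad (p i i) (p i j) (E i) (E j) (m + 1) =
      (E i * (qad (p i i) (p i j) (E i) (E j) m * F j -
          F j * qad (p i i) (p i j) (E i) (E j) m) -
        (p i i ^ m * p i j) • ((qad (p i i) (p i j) (E i) (E j) m * F j -
          F j * qad (p i i) (p i j) (E i) (E j) m) * E i)) := by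
    intro m
    rw [qad]
    generalize qad (p i i) (p i j) (E i) (E j) m = X
    simp only [mul_sub, sub_mul, smul_sub, smul_mul_assoc, mul_smul_comm, mul_assoc]
    rw [h0, ← mul_assoc (F j) (E i), ← h0, mul_assoc]
    abel
  have hc := hp j i
  induction m with
  | zero =>
    refine ⟨(δ j)⁻¹ * (p j i)⁻¹, ?_⟩
    rw [step 0]
    simp only [qad]
    rw [hEF, mul_smul_comm, smul_mul_assoc, mul_sub, sub_mul, hE, hE']
    simp only [pow_zero, one_mul, zero_add, pow_one]
    match_scalars <;> field_simp
    ring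
  | succ m ih =>
    obtain ⟨κ, hκ⟩ := ih
    refine ⟨κ * (1 - p i i ^ m * (p i j * p j i)) * (p j i)⁻¹, ?_⟩
    rw [step (m + 1), hκ, mul_smul_comm, smul_mul_assoc, ← mul_assoc (E i) (W j), hE,
      smul_mul_assoc, mul_assoc (W j), mul_assoc (W j), ← pow_succ, ← pow_succ']
    match_scalars
    field_simp

theorem commute_qad_f (hp : ∀ i j, p i j ≠ 0) (h : DoubleRels p δ E F W W') {i j : Fin n}
    (hij : i ≠ j) {m : ℕ} (hm : p i i ^ m * (p i j * p j i) = 1) (k : Fin n) :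
    Commute (qad (p i i) (p i j) (E i) (E j) (m + 1)) (F k) := by
  refine sub_eq_zero.mp ?_
  by_cases hi : k = i
  · subst hi
    rw [h.qad_comm_f_self hp hij, hm]
    simp
  by_cases hj : k = j
  · subst hj
    obtain ⟨κ, hκ⟩ := h.qad_comm_f_right hp hij m
    rw [hκ, hm]
    simp
  have hEi : Commute (E i) (F k) := sub_eq_zero.mp (by rw [h.ef, if_neg (Ne.symm hi)])
  have hEj : Commute (E j) (F k) := sub_eq_zero.mp (by rw [h.ef, if_neg (Ne.symm hj)])
  rw [sub_eq_zero]
  have : ∀ m, Commute (qad (p i i) (p i j) (E i) (E j) m) (F k) := fun m => by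
    induction m with
    | zero => exact hEj
    | succ m ih => exact (hEi.mul_left ih).sub_left ((ih.mul_left hEi).smul_left _)
  exact this (m + 1)

variable {a : Fin n → Fin n → ℤ} {d : Fin n → ℤ} {r s : K}

theorem commute_serreElt (hr : r ≠ 0) (hs : s ≠ 0) (hoff : ∀ i j, i ≠ j → a i j ≤ 0)
    (hsym : ∀ i j, d i * a i j = d j * a j i) (h : DoubleRels (wt a d r s) δ E F W W')
    {i j : Fin n} (hij : i ≠ j) (k : Fin n) : Commute (serreElt a d r s E i j) (F k) := by
  obtain ⟨m, hm, hm'⟩ := exists_wt_pow_mul_eq_one hr hs hoff hsym hij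
  rw [serreElt_eq_qad, hm]
  exact h.commute_qad_f (wt_ne_zero hr hs) hij hm' k

theorem commute_serreEltF (hr : r ≠ 0) (hs : s ≠ 0) (hoff : ∀ i j, i ≠ j → a i j ≤ 0)
    (hsym : ∀ i j, d i * a i j = d j * a j i) (h : DoubleRels (wt a d r s) δ E F W W')
    {i j : Fin n} (hij : i ≠ j) (k : Fin n) : Commute (serreEltF a d r s F i j) (E k) := by
  have := (h.op (wt_ne_zero hr hs)).commute_serreElt hr hs hoff hsym hij k
  rw [← op_serreEltF] at this
  exact this.unop

end DoubleRels

section Verma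

variable {K : Type} [Field K] {n : ℕ}

theorem FreeAlgebra.mem_of_ι_mul_mem (S : Submodule K (FreeAlgebra K (Fin n))) (h1 : 1 ∈ S)
    (hmul : ∀ k, ∀ x ∈ S, FreeAlgebra.ι K k * x ∈ S) (x : FreeAlgebra K (Fin n)) : x ∈ S := by
  have key : ∀ y ∈ S, x * y ∈ S := by
    induction x using FreeAlgebra.induction with
    | grade0 c => intro y hy; rw [← Algebra.smul_def]; exact S.smul_mem c hy
    | grade1 k => exact hmul k
    | mul u v hu hv => intro y hy; rw [mul_assoc]; exact hu _ (hv y hy)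
    | add u v hu hv => intro y hy; rw [add_mul]; exact S.add_mem (hu y hy) (hv y hy)
  simpa using key 1 h1

/-- The endomorphism of the free algebra rescaling the generators. -/
def scaleHom (t : Fin n → K) : FreeAlgebra K (Fin n) →ₐ[K] FreeAlgebra K (Fin n) :=
  FreeAlgebra.lift K fun k => t k • FreeAlgebra.ι K k

@[simp]
theorem scaleHom_ι (t : Fin n → K) (k : Fin n) :
    scaleHom t (FreeAlgebra.ι K k) = t k • FreeAlgebra.ι K k := by
  simp [scaleHom]

theorem scaleHom_comp (t u : Fin n → K) :
    (scaleHom t).comp (scaleHom u) = scaleHom (t * u) := by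
  ext k
  simp [smul_smul, mul_comm]

theorem scaleHom_scaleHom (t u : Fin n → K) (x : FreeAlgebra K (Fin n)) :
    scaleHom t (scaleHom u x) = scaleHom (t * u) x :=
  DFunLike.congr_fun (scaleHom_comp t u) x

theorem scaleHom_one : scaleHom (1 : Fin n → K) = AlgHom.id K _ := by
  ext k
  simp

theorem scaleHom_inv_scaleHom {t : Fin n → K} (ht : ∀ k, t k ≠ 0) (x : FreeAlgebra K (Fin n)) :
    scaleHom t⁻¹ (scaleHom t x) = x := by
  rw [scaleHom_scaleHom, show t⁻¹ * t = 1 from funext fun k => inv_mul_cancel₀ (ht k),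
    scaleHom_one, AlgHom.id_apply]

theorem scaleHom_scaleHom_inv {t : Fin n → K} (ht : ∀ k, t k ≠ 0) (x : FreeAlgebra K (Fin n)) :
    scaleHom t (scaleHom t⁻¹ x) = x := by
  rw [scaleHom_scaleHom, mul_comm, ← scaleHom_scaleHom, scaleHom_inv_scaleHom ht]

/-- Left multiplication by `x_k` on the first component, twisted by `-δ_{jk} H` into the second. -/
def loweringStep (H : Module.End K (FreeAlgebra K (Fin n))) (j k : Fin n) :
    Module.End K (FreeAlgebra K (Fin n) × FreeAlgebra K (Fin n)) :=
  LinearMap.prod (LinearMap.mulLeft K (FreeAlgebra.ι K k) ∘ₗ LinearMap.fst K _ _)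
    (LinearMap.mulLeft K (FreeAlgebra.ι K k) ∘ₗ LinearMap.snd K _ _ -
      if j = k then H ∘ₗ LinearMap.fst K _ _ else 0)

theorem loweringStep_apply (H : Module.End K (FreeAlgebra K (Fin n))) (j k : Fin n)
    (x : FreeAlgebra K (Fin n) × FreeAlgebra K (Fin n)) :
    loweringStep H j k x = (FreeAlgebra.ι K k * x.1,
      FreeAlgebra.ι K k * x.2 - if j = k then H x.1 else 0) := by
  unfold loweringStep
  split_ifs <;> rfl

/-- The map `x ↦ (x, L x)`, where `L = lowering H j`. -/
def loweringGraph (H : Module.End K (FreeAlgebra K (Fin n))) (j : Fin n) :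
    FreeAlgebra K (Fin n) →ₗ[K] FreeAlgebra K (Fin n) × FreeAlgebra K (Fin n) :=
  LinearMap.applyₗ ((1, 0) : FreeAlgebra K (Fin n) × FreeAlgebra K (Fin n)) ∘ₗ
    (FreeAlgebra.lift K (loweringStep H j)).toLinearMap

theorem loweringGraph_one (H : Module.End K (FreeAlgebra K (Fin n))) (j : Fin n) :
    loweringGraph H j 1 = (1, 0) := by
  simp [loweringGraph]

theorem loweringGraph_ι_mul (H : Module.End K (FreeAlgebra K (Fin n))) (j k : Fin n)
    (x : FreeAlgebra K (Fin n)) :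
    loweringGraph H j (FreeAlgebra.ι K k * x) = loweringStep H j k (loweringGraph H j x) := by
  simp [loweringGraph]

theorem loweringGraph_fst (H : Module.End K (FreeAlgebra K (Fin n))) (j : Fin n)
    (x : FreeAlgebra K (Fin n)) : (loweringGraph H j x).1 = x := by
  refine FreeAlgebra.mem_of_ι_mul_mem (LinearMap.eqLocus
    (LinearMap.fst K _ _ ∘ₗ loweringGraph H j) LinearMap.id) ?_ (fun k y hy => ?_) x
  · simp [LinearMap.mem_eqLocus, loweringGraph_one]
  · simp only [LinearMap.mem_eqLocus, LinearMap.coe_comp, Function.comp_apply,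
      LinearMap.fst_apply, LinearMap.id_apply] at hy ⊢
    rw [loweringGraph_ι_mul, loweringStep_apply, hy]

/-- The linear map `L` on the free algebra with `L 1 = 0` and
`L (x_k P) = x_k L P - δ_{jk} H P`. -/
def lowering (H : Module.End K (FreeAlgebra K (Fin n))) (j : Fin n) :
    Module.End K (FreeAlgebra K (Fin n)) :=
  LinearMap.snd K _ _ ∘ₗ loweringGraph H j

theorem lowering_one (H : Module.End K (FreeAlgebra K (Fin n))) (j : Fin n) :
    lowering H j 1 = 0 := by
  simp [lowering, loweringGraph_one]

theorem lowering_ι_mul (H : Module.End K (FreeAlgebra K (Fin n))) (j k : Fin n)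
    (x : FreeAlgebra K (Fin n)) :
    lowering H j (FreeAlgebra.ι K k * x) =
      FreeAlgebra.ι K k * lowering H j x - if j = k then H x else 0 := by
  simp only [lowering, LinearMap.coe_comp, Function.comp_apply, loweringGraph_ι_mul,
    loweringStep_apply, LinearMap.snd_apply, loweringGraph_fst]

theorem scaleHom_lowering (t : Fin n → K) (H : Module.End K (FreeAlgebra K (Fin n))) (j : Fin n)
    (htj : t j ≠ 0) (hH : ∀ x, scaleHom t (H x) = H (scaleHom t x)) (x : FreeAlgebra K (Fin n)) :
    scaleHom t (lowering H j x) = (t j)⁻¹ • lowering H j (scaleHom t x) := by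
  refine FreeAlgebra.mem_of_ι_mul_mem (LinearMap.eqLocus
    ((scaleHom t).toLinearMap ∘ₗ lowering H j)
    ((t j)⁻¹ • (lowering H j ∘ₗ (scaleHom t).toLinearMap))) ?_ (fun k y hy => ?_) x
  · simp [LinearMap.mem_eqLocus, lowering_one]
  · simp only [LinearMap.mem_eqLocus, LinearMap.coe_comp, Function.comp_apply,
      AlgHom.toLinearMap_apply, LinearMap.smul_apply] at hy ⊢
    rw [lowering_ι_mul, map_sub, map_mul, map_mul, hy, scaleHom_ι, smul_mul_assoc,
      smul_mul_assoc, map_smul, lowering_ι_mul]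
    by_cases h : j = k
    · subst h
      rw [if_pos rfl, if_pos rfl, hH, smul_smul, inv_mul_cancel₀ htj, one_smul, mul_smul_comm,
        smul_smul, mul_inv_cancel₀ htj, one_smul]
    · rw [if_neg h, if_neg h]
      simp only [map_zero, sub_zero, mul_smul_comm, smul_smul, mul_comm]

/-- The action of `ω_i` on the free algebra, a lowest weight module with weight `c`. -/
def vermaW (p : Fin n → Fin n → K) (c : K) (i : Fin n) : Module.End K (FreeAlgebra K (Fin n)) :=
  c • (scaleHom (p i)).toLinearMap

/-- The action of `ω_i'` on the free algebra. -/
def vermaW' (p : Fin n → Fin n → K) (i : Fin n) : Module.End K (FreeAlgebra K (Fin n)) :=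
  (scaleHom fun k => (p k i)⁻¹).toLinearMap

/-- The action of `e_i` on the free algebra. -/
def vermaE (i : Fin n) : Module.End K (FreeAlgebra K (Fin n)) :=
  LinearMap.mulLeft K (FreeAlgebra.ι K i)

/-- The action of `f_i` on the free algebra. -/
def vermaF (p : Fin n → Fin n → K) (δ : Fin n → K) (c : K) (i : Fin n) :
    Module.End K (FreeAlgebra K (Fin n)) :=
  lowering ((δ i)⁻¹ • (vermaW p c i - vermaW' p i)) i

theorem vermaRels (p : Fin n → Fin n → K) (hp : ∀ i j, p i j ≠ 0) (δ : Fin n → K) (c : K) :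
    DoubleRels p δ vermaE (vermaF p δ c) (vermaW p c) (vermaW' p) := by
  have hH : ∀ (t : Fin n → K) (j : Fin n) (x : FreeAlgebra K (Fin n)),
      scaleHom t (((δ j)⁻¹ • (vermaW p c j - vermaW' p j)) x) =
        ((δ j)⁻¹ • (vermaW p c j - vermaW' p j)) (scaleHom t x) := fun t j x => by
    simp [vermaW, vermaW', scaleHom_scaleHom, mul_comm]
  refine ⟨fun i j => ?_, fun i j => ?_, fun i j => ?_, fun i j => ?_, fun i j => ?_⟩ <;>
    refine LinearMap.ext fun x => ?_
  · simp [vermaW, vermaE, smul_smul, mul_comm]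
  · simp [vermaW', vermaE]
  · have := scaleHom_lowering (p i) _ j (hp i j) (hH _ j) x
    change c • scaleHom (p i) (vermaF p δ c j x) =
      (p i j)⁻¹ • vermaF p δ c j (c • scaleHom (p i) x)
    rw [vermaF, this, map_smul, smul_comm]
  · have := scaleHom_lowering (fun k => (p k i)⁻¹) _ j (inv_ne_zero (hp j i)) (hH _ j) x
    rw [inv_inv] at this
    exact this
  · simp only [Module.End.mul_apply, LinearMap.sub_apply, vermaE, vermaF,
      LinearMap.mulLeft_apply, lowering_ι_mul]
    by_cases h : i = j
    · subst h; simp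
    · simp [h, Ne.symm h]

/-- The two-sided ideal of the free algebra generated by the quantum Serre elements. -/
def serreIdeal (a : Fin n → Fin n → ℤ) (d : Fin n → ℤ) (r s : K) :
    Submodule K (FreeAlgebra K (Fin n)) :=
  Submodule.span K {z | ∃ i j, i ≠ j ∧ ∃ x y,
    z = x * serreElt a d r s (FreeAlgebra.ι K) i j * y}

variable {a : Fin n → Fin n → ℤ} {d : Fin n → ℤ} {r s : K}

theorem mul_serreElt_mul_mem {i j : Fin n} (hij : i ≠ j) (x y : FreeAlgebra K (Fin n)) :
    x * serreElt a d r s (FreeAlgebra.ι K) i j * y ∈ serreIdeal a d r s :=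
  Submodule.subset_span ⟨i, j, hij, x, y, rfl⟩

theorem mul_mem_serreIdeal (u : FreeAlgebra K (Fin n)) {z : FreeAlgebra K (Fin n)}
    (hz : z ∈ serreIdeal a d r s) : u * z ∈ serreIdeal a d r s := by
  suffices h : serreIdeal a d r s ≤ (serreIdeal a d r s).comap (LinearMap.mulLeft K u) from h hz
  refine Submodule.span_le.mpr ?_
  rintro _ ⟨i, j, hij, x, y, rfl⟩
  have := mul_serreElt_mul_mem (a := a) (d := d) (r := r) (s := s) hij (u * x) y
  simpa [mul_assoc] using this

theorem scaleHom_mem_serreIdeal (t : Fin n → K) {z : FreeAlgebra K (Fin n)}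
    (hz : z ∈ serreIdeal a d r s) : scaleHom t z ∈ serreIdeal a d r s := by
  suffices h : serreIdeal a d r s ≤ (serreIdeal a d r s).comap (scaleHom t).toLinearMap from h hz
  refine Submodule.span_le.mpr ?_
  rintro _ ⟨i, j, hij, x, y, rfl⟩
  simp only [SetLike.mem_coe, Submodule.mem_comap, AlgHom.toLinearMap_apply, map_mul,
    map_serreElt, scaleHom_ι, serreElt_smul, mul_smul_comm, smul_mul_assoc]
  exact Submodule.smul_mem _ _ (mul_serreElt_mul_mem hij _ _)

theorem serreElt_vermaE (i j : Fin n) :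
    serreElt a d r s (vermaE (K := K)) i j =
      LinearMap.mulLeft K (serreElt a d r s (FreeAlgebra.ι K) i j) :=
  (map_serreElt (Algebra.lmul K (FreeAlgebra K (Fin n))) _ i j).symm

theorem vermaW_mem_serreIdeal (p : Fin n → Fin n → K) (c : K) (i : Fin n)
    {z : FreeAlgebra K (Fin n)} (hz : z ∈ serreIdeal a d r s) :
    vermaW p c i z ∈ serreIdeal a d r s :=
  Submodule.smul_mem _ _ (scaleHom_mem_serreIdeal _ hz)

theorem vermaF_mem_serreIdeal (hr : r ≠ 0) (hs : s ≠ 0) (hoff : ∀ i j, i ≠ j → a i j ≤ 0)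
    (hsym : ∀ i j, d i * a i j = d j * a j i) (δ : Fin n → K) (c : K) (k : Fin n)
    {z : FreeAlgebra K (Fin n)} (hz : z ∈ serreIdeal a d r s) :
    vermaF (wt a d r s) δ c k z ∈ serreIdeal a d r s := by
  suffices h : serreIdeal a d r s ≤
      (serreIdeal a d r s).comap (vermaF (wt a d r s) δ c k) from h hz
  refine Submodule.span_le.mpr ?_
  rintro _ ⟨i, j, hij, x, y, rfl⟩
  have hc := (vermaRels (wt a d r s) (wt_ne_zero hr hs) δ c).commute_serreElt hr hs hoff hsym
    hij k
  rw [serreElt_vermaE] at hc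
  have hc' := LinearMap.congr_fun hc.eq y
  simp only [Module.End.mul_apply, LinearMap.mulLeft_apply] at hc'
  have hmem := fun x y => mul_serreElt_mul_mem (a := a) (d := d) (r := r) (s := s) hij x y
  generalize serreElt a d r s (FreeAlgebra.ι K) i j = S at hc' hmem
  rw [SetLike.mem_coe, Submodule.mem_comap, mul_assoc]
  refine FreeAlgebra.mem_of_ι_mul_mem ((serreIdeal a d r s).comap
    (vermaF (wt a d r s) δ c k ∘ₗ LinearMap.mulRight K (S * y))) ?_ (fun l u hu => ?_) x
  · simp only [Submodule.mem_comap, LinearMap.coe_comp, Function.comp_apply,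
      LinearMap.mulRight_apply, one_mul, ← hc']
    simpa using hmem 1 (vermaF (wt a d r s) δ c k y)
  · simp only [Submodule.mem_comap, LinearMap.coe_comp, Function.comp_apply,
      LinearMap.mulRight_apply] at hu ⊢
    have hm := hmem u y
    rw [mul_assoc] at hm
    rw [mul_assoc, vermaF, lowering_ι_mul]
    refine Submodule.sub_mem _ (mul_mem_serreIdeal _ hu) ?_
    split_ifs with h
    · exact Submodule.smul_mem _ _ (Submodule.sub_mem _
        (vermaW_mem_serreIdeal _ _ _ hm) (scaleHom_mem_serreIdeal _ hm))
    · exact Submodule.zero_mem _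

end Verma

section Stabilizer

variable {K M : Type} [Field K] [AddCommGroup M] [Module K M]

/-- The algebra of endomorphisms preserving a submodule. -/
def endStabilizer (N : Submodule K M) : Subalgebra K (Module.End K M) where
  carrier := {f | ∀ x ∈ N, f x ∈ N}
  mul_mem' hf hg x hx := hf _ (hg x hx)
  add_mem' hf hg x hx := N.add_mem (hf x hx) (hg x hx)
  algebraMap_mem' c _ hx := N.smul_mem c hx

/-- The action of the stabilizer of a submodule on the quotient. -/
def endStabilizer.toQuotient (N : Submodule K M) :
    endStabilizer N →ₐ[K] Module.End K (M ⧸ N) :=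
  AlgHom.ofLinearMap
    { toFun := fun f => N.mapQ N f.1 f.2
      map_add' := fun f g => by ext; rfl
      map_smul' := fun c f => by ext; rfl }
    (by ext; rfl) (fun f g => by ext; rfl)

@[simp]
theorem endStabilizer.toQuotient_mk (N : Submodule K M) (f : endStabilizer N) (x : M) :
    endStabilizer.toQuotient N f (Submodule.Quotient.mk x) =
      Submodule.Quotient.mk ((f : Module.End K M) x) :=
  rfl

end Stabilizer

section QuantumGroup

variable {n : ℕ} {a : Fin n → Fin n → ℤ} {d : Fin n → ℤ}

theorem rr_ne_zero : rr ≠ 0 :=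
  (map_ne_zero_iff _ (IsFractionRing.injective _ K2)).mpr (MvPolynomial.X_ne_zero 0)

theorem ss_ne_zero : ss ≠ 0 :=
  (map_ne_zero_iff _ (IsFractionRing.injective _ K2)).mpr (MvPolynomial.X_ne_zero 1)

theorem rr_zpow_sub_ss_zpow_ne_zero {e : ℤ} (he : 0 < e) : rr ^ e - ss ^ e ≠ 0 := by
  lift e to ℕ using he.le
  intro h
  rw [zpow_natCast, zpow_natCast, sub_eq_zero, rr, ss, ← map_pow, ← map_pow] at h
  have heval := congrArg (MvPolynomial.eval ![(0 : ℚ), 1])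
    (IsFractionRing.injective (MvPolynomial (Fin 2) ℚ) K2 h)
  have he' : e ≠ 0 := by omega
  simp [he'] at heval

/-- The action of the generators of `U_{r,s}(𝔤)` on the free algebra. -/
def vermaGen {K : Type} [Field K] (p : Fin n → Fin n → K) (δ : Fin n → K) (c : K) :
    Gen n → Module.End K (FreeAlgebra K (Fin n))
  | Gen.e i => vermaE i
  | Gen.f i => vermaF p δ c i
  | Gen.w i => vermaW p c i
  | Gen.winv i => c⁻¹ • (scaleHom (p i)⁻¹).toLinearMap
  | Gen.w' i => vermaW' p i
  | Gen.w'inv i => (scaleHom fun k => p k i).toLinearMap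

theorem vermaGen_tor {K : Type} [Field K] (p : Fin n → Fin n → K) (δ : Fin n → K) (c : K)
    (i : Fin n) (x y : Bool) :
    ∃ (b : K) (t : Fin n → K), vermaGen p δ c (tor i x y) = b • (scaleHom t).toLinearMap := by
  cases x <;> cases y
  · exact ⟨c, p i, rfl⟩
  · exact ⟨c⁻¹, (p i)⁻¹, rfl⟩
  · exact ⟨1, _, (one_smul _ _).symm⟩
  · exact ⟨1, _, (one_smul _ _).symm⟩

theorem vermaGen_mem {K : Type} [Field K] {r s : K} (hr : r ≠ 0) (hs : s ≠ 0)
    (hoff : ∀ i j, i ≠ j → a i j ≤ 0) (hsym : ∀ i j, d i * a i j = d j * a j i)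
    (δ : Fin n → K) (c : K) (g : Gen n) :
    vermaGen (wt a d r s) δ c g ∈ endStabilizer (serreIdeal a d r s) := by
  intro x hx
  cases g with
  | e i => exact mul_mem_serreIdeal _ hx
  | f i => exact vermaF_mem_serreIdeal hr hs hoff hsym _ _ _ hx
  | w i => exact vermaW_mem_serreIdeal _ _ _ hx
  | winv i => exact Submodule.smul_mem _ _ (scaleHom_mem_serreIdeal _ hx)
  | w' i => exact scaleHom_mem_serreIdeal _ hx
  | w'inv i => exact scaleHom_mem_serreIdeal _ hx

theorem serreEltF_apply_eq_zero {K : Type} [Field K] {r s : K} {M : Type} [AddCommGroup M]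
    [Module K M] (F : Fin n → Module.End K M) (v : M) (hv : ∀ k, F k v = 0) (i j : Fin n) :
    serreEltF a d r s F i j v = 0 := by
  rw [serreEltF, LinearMap.sum_apply]
  refine Finset.sum_eq_zero fun k _ => ?_
  rw [LinearMap.smul_apply, Module.End.mul_apply, Module.End.mul_apply]
  generalize (1 - a i j).toNat - k = l
  cases l with
  | zero => simp [hv]
  | succ l => simp [pow_succ, hv]

/-- The generators of `U_{r,s}(𝔤)` act on the free algebra modulo the Serre relations. -/
theorem exists_vermaQuotient {K : Type} [Field K] {r s : K} (hr : r ≠ 0) (hs : s ≠ 0)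
    (hoff : ∀ i j, i ≠ j → a i j ≤ 0) (hsym : ∀ i j, d i * a i j = d j * a j i)
    (δ : Fin n → K) (c : K) :
    ∃ G : Gen n → Module.End K (FreeAlgebra K (Fin n) ⧸ serreIdeal a d r s),
      (∀ g x, G g (Submodule.Quotient.mk x) =
        Submodule.Quotient.mk (vermaGen (wt a d r s) δ c g x)) ∧
      DoubleRels (wt a d r s) δ (fun i => G (Gen.e i)) (fun i => G (Gen.f i))
        (fun i => G (Gen.w i)) (fun i => G (Gen.w' i)) ∧
      (∀ i j, i ≠ j → serreElt a d r s (fun k => G (Gen.e k)) i j = 0) ∧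
      ∀ i j, i ≠ j → serreEltF a d r s (fun k => G (Gen.f k)) i j = 0 := by
  obtain ⟨S, hS⟩ : ∃ S : Gen n → endStabilizer (serreIdeal a d r s),
      ∀ g, (S g : Module.End K (FreeAlgebra K (Fin n))) = vermaGen (wt a d r s) δ c g :=
    ⟨fun g => ⟨_, vermaGen_mem hr hs hoff hsym δ c g⟩, fun _ => rfl⟩
  have hT := vermaRels (wt a d r s) (wt_ne_zero hr hs) δ c
  have hSrels : DoubleRels (wt a d r s) δ (fun i => S (Gen.e i)) (fun i => S (Gen.f i))
      (fun i => S (Gen.w i)) (fun i => S (Gen.w' i)) := by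
    refine ⟨fun i j => Subtype.ext ?_, fun i j => Subtype.ext ?_, fun i j => Subtype.ext ?_,
      fun i j => Subtype.ext ?_, fun i j => Subtype.ext ?_⟩
    · simpa [hS, vermaGen] using hT.we i j
    · simpa [hS, vermaGen] using hT.w'e i j
    · simpa [hS, vermaGen] using hT.wf i j
    · simpa [hS, vermaGen] using hT.w'f i j
    · have h := hT.ef i j
      split_ifs at h ⊢ <;> simpa [hS, vermaGen] using h
  have hG := hSrels.map (endStabilizer.toQuotient _)
  refine ⟨fun g => endStabilizer.toQuotient _ (S g), fun g x => ?_, hG, fun i j hij => ?_,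
    fun i j hij => ?_⟩
  · rw [endStabilizer.toQuotient_mk, hS]
  · refine (map_serreElt (endStabilizer.toQuotient _) (fun k => S (Gen.e k)) i j).symm.trans ?_
    refine LinearMap.ext fun z => ?_
    obtain ⟨z, rfl⟩ := Submodule.Quotient.mk_surjective _ z
    have h : ((serreElt a d r s (fun k => S (Gen.e k)) i j :
        endStabilizer (serreIdeal a d r s)) : Module.End K (FreeAlgebra K (Fin n))) =
        LinearMap.mulLeft K (serreElt a d r s (FreeAlgebra.ι K) i j) := by
      rw [← serreElt_vermaE]
      refine (map_serreElt (B := endStabilizer (serreIdeal a d r s))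
        (C := Module.End K (FreeAlgebra K (Fin n)))
        (endStabilizer (serreIdeal a d r s)).val _ i j).trans ?_
      simp only [Subalgebra.coe_val, hS]
      rfl
    rw [endStabilizer.toQuotient_mk, h, LinearMap.zero_apply, Submodule.Quotient.mk_eq_zero,
      LinearMap.mulLeft_apply]
    simpa using mul_serreElt_mul_mem (a := a) (d := d) (r := r) (s := s) hij 1 z
  · refine LinearMap.ext fun z => ?_
    obtain ⟨z, rfl⟩ := Submodule.Quotient.mk_surjective _ z
    refine FreeAlgebra.mem_of_ι_mul_mem (LinearMap.ker
      (serreEltF a d r s (fun k => endStabilizer.toQuotient _ (S (Gen.f k))) i j ∘ₗ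
        Submodule.mkQ (serreIdeal a d r s))) ?_ (fun k x hx => ?_) z
    · refine serreEltF_apply_eq_zero _ _ (fun k => ?_) i j
      rw [Submodule.mkQ_apply, endStabilizer.toQuotient_mk, hS]
      exact congrArg Submodule.Quotient.mk (lowering_one _ _)
    · have h := LinearMap.congr_fun (hG.commute_serreEltF hr hs hoff hsym hij k).eq
        (Submodule.Quotient.mk x)
      rw [Module.End.mul_apply, Module.End.mul_apply, endStabilizer.toQuotient_mk, hS] at h
      refine h.trans ?_
      have hx0 : serreEltF a d r s (fun k => endStabilizer.toQuotient _ (S (Gen.f k))) i j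
        (Submodule.Quotient.mk x : FreeAlgebra K (Fin n) ⧸ serreIdeal a d r s) = 0 := hx
      rw [hx0, map_zero]

/-- For every nonzero scalar `c`, the algebra `U_{r,s}(𝔤)` acts on the free algebra modulo the
Serre relations, as on a lowest weight Verma module. -/
theorem exists_vermaHom (hoff : ∀ i j, i ≠ j → a i j ≤ 0)
    (hsym : ∀ i j, d i * a i j = d j * a j i) {c : K2} (hc : c ≠ 0) :
    ∃ Φ : Uq a d →ₐ[K2] Module.End K2 (FreeAlgebra K2 (Fin n) ⧸ serreIdeal a d rr ss),
      ∀ g x, Φ (gU a d g) (Submodule.Quotient.mk x) =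
        Submodule.Quotient.mk
          (vermaGen (wt a d rr ss) (fun i => rr ^ d i - ss ^ d i) c g x) := by
  have hp := wt_ne_zero (a := a) (d := d) rr_ne_zero ss_ne_zero
  set δ : Fin n → K2 := fun i => rr ^ d i - ss ^ d i with hδ
  obtain ⟨G, hGx, hG, hGE, hGF⟩ :=
    exists_vermaQuotient (a := a) (d := d) rr_ne_zero ss_ne_zero hoff hsym δ c
  have hGmul : ∀ g g' x, (G g * G g') (Submodule.Quotient.mk x) = Submodule.Quotient.mk
      (vermaGen (wt a d rr ss) δ c g (vermaGen (wt a d rr ss) δ c g' x)) := fun g g' x => by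
    rw [Module.End.mul_apply, hGx, hGx]
  have hinv : ∀ g g', (∀ x, vermaGen (wt a d rr ss) δ c g
      (vermaGen (wt a d rr ss) δ c g' x) = x) → G g * G g' = 1 := fun g g' h =>
    LinearMap.ext fun x => by
      obtain ⟨x, rfl⟩ := Submodule.Quotient.mk_surjective _ x
      rw [hGmul, h]
      rfl
  have hrel : ∀ ⦃x y⦄, URel a d x y → FreeAlgebra.lift K2 G x = FreeAlgebra.lift K2 G y := by
    intro x y h
    cases h with
    | torComm i j x y x' y' =>
      simp only [map_mul, FreeAlgebra.lift_ι_apply]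
      obtain ⟨b, t, h⟩ := vermaGen_tor (wt a d rr ss) δ c i x y
      obtain ⟨b', t', h'⟩ := vermaGen_tor (wt a d rr ss) δ c j x' y'
      refine LinearMap.ext fun z => ?_
      obtain ⟨z, rfl⟩ := Submodule.Quotient.mk_surjective _ z
      rw [hGmul, hGmul, h, h']
      simp only [LinearMap.smul_apply, AlgHom.toLinearMap_apply, map_smul, scaleHom_scaleHom]
      rw [mul_comm t, smul_comm]
    | wInvR i =>
      simp only [map_mul, FreeAlgebra.lift_ι_apply, map_one]
      refine hinv _ _ fun x => ?_
      simp [vermaGen, vermaW, scaleHom_scaleHom_inv (hp i), smul_smul, hc]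
    | wInvL i =>
      simp only [map_mul, FreeAlgebra.lift_ι_apply, map_one]
      refine hinv _ _ fun x => ?_
      simp [vermaGen, vermaW, scaleHom_inv_scaleHom (hp i), smul_smul, hc]
    | w'InvR i =>
      simp only [map_mul, FreeAlgebra.lift_ι_apply, map_one]
      exact hinv _ _ fun x => scaleHom_inv_scaleHom (fun k => hp k i) x
    | w'InvL i =>
      simp only [map_mul, FreeAlgebra.lift_ι_apply, map_one]
      exact hinv _ _ fun x => scaleHom_scaleHom_inv (fun k => hp k i) x
    | we i j =>
      simp only [map_mul, map_smul, FreeAlgebra.lift_ι_apply]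
      exact hG.we i j
    | w'e i j =>
      simp only [map_mul, map_smul, FreeAlgebra.lift_ι_apply]
      rw [← wt_inv]
      exact hG.w'e i j
    | wf i j =>
      simp only [map_mul, map_smul, FreeAlgebra.lift_ι_apply]
      rw [← wt_inv]
      exact hG.wf i j
    | w'f i j =>
      simp only [map_mul, map_smul, FreeAlgebra.lift_ι_apply]
      exact hG.w'f i j
    | ef i j =>
      have h := hG.ef i j
      simp only [map_mul, map_sub, FreeAlgebra.lift_ι_apply]
      rw [h]
      split_ifs <;> simp [hδ]
    | serreE i j hij =>
      rw [map_zero]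
      refine (map_serreElt (FreeAlgebra.lift K2 G) _ i j).trans ?_
      simpa only [FreeAlgebra.lift_ι_apply] using hGE i j hij
    | serreF i j hij =>
      rw [map_zero]
      refine (map_serreEltF (FreeAlgebra.lift K2 G) _ i j).trans ?_
      simpa only [FreeAlgebra.lift_ι_apply] using hGF i j hij
  refine ⟨RingQuot.liftAlgHom K2 ⟨FreeAlgebra.lift K2 G, hrel⟩, fun g x => ?_⟩
  rw [gU, RingQuot.liftAlgHom_mkAlgHom_apply, FreeAlgebra.lift_ι_apply, hGx]

/-- The projection of the free algebra onto `U⁺`. -/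
def freeToUpos (a : Fin n → Fin n → ℤ) (d : Fin n → ℤ) :
    FreeAlgebra K2 (Fin n) →ₐ[K2] ↥(Upos a d) :=
  FreeAlgebra.lift K2 (eUp a d)

theorem freeToUpos_ι_mul (k : Fin n) (x : FreeAlgebra K2 (Fin n)) :
    freeToUpos a d (FreeAlgebra.ι K2 k * x) = eUp a d k * freeToUpos a d x := by
  rw [map_mul, freeToUpos, FreeAlgebra.lift_ι_apply]

theorem freeToUpos_surjective : Function.Surjective (freeToUpos a d) := by
  rintro ⟨P, hP⟩
  suffices h : Upos a d ≤ ((Upos a d).val.comp (freeToUpos a d)).range by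
    obtain ⟨x, hx⟩ := h hP
    exact ⟨x, Subtype.ext hx⟩
  refine Algebra.adjoin_le ?_
  rintro _ ⟨k, rfl⟩
  exact ⟨FreeAlgebra.ι K2 k, by simp [freeToUpos, eUp]⟩

theorem freeToUpos_eq_zero {x : FreeAlgebra K2 (Fin n)} (hx : x ∈ serreIdeal a d rr ss) :
    freeToUpos a d x = 0 := by
  suffices h : serreIdeal a d rr ss ≤ LinearMap.ker (freeToUpos a d).toLinearMap from h hx
  refine Submodule.span_le.mpr ?_
  rintro _ ⟨i, j, hij, x, y, rfl⟩
  have h0 : freeToUpos a d (serreElt a d rr ss (FreeAlgebra.ι K2) i j) = 0 := by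
    refine Subtype.ext ?_
    have h := RingQuot.mkAlgHom_rel K2 (URel.serreE (a := a) (d := d) i j hij)
    rw [map_zero] at h
    have h' := map_serreElt (B := FreeAlgebra K2 (Gen n)) (C := Uq a d) (a := a) (d := d) (r := rr)
      (s := ss) (RingQuot.mkAlgHom K2 (URel a d)) (fun k => FreeAlgebra.ι K2 (Gen.e k)) i j
    refine Eq.trans ?_ (h'.symm.trans h)
    refine (map_serreElt (B := FreeAlgebra K2 (Fin n)) (C := Uq a d)
      ((Upos a d).val.comp (freeToUpos a d)) (FreeAlgebra.ι K2) i j).trans ?_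
    simp only [AlgHom.comp_apply, freeToUpos, FreeAlgebra.lift_ι_apply]
    rfl
  simp [h0]

/-- The subspaces `ω_i U⁺` and `ω_i' U⁺` of `U_{r,s}(𝔤)` are independent. -/
theorem eq_zero_of_w_mul_eq_w'_mul (hoff : ∀ i j, i ≠ j → a i j ≤ 0)
    (hsym : ∀ i j, d i * a i j = d j * a j i) (i : Fin n) (A B : ↥(Upos a d))
    (h : gU a d (Gen.w i) * (A : Uq a d) = gU a d (Gen.w' i) * (B : Uq a d)) :
    A = 0 ∧ B = 0 := by
  obtain ⟨x, rfl⟩ := freeToUpos_surjective A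
  obtain ⟨y, rfl⟩ := freeToUpos_surjective B
  have hp := wt_ne_zero (a := a) (d := d) rr_ne_zero ss_ne_zero
  have key : ∀ c : K2, c ≠ 0 →
      c • scaleHom (wt a d rr ss i) x - scaleHom (fun k => (wt a d rr ss k i)⁻¹) y ∈
        serreIdeal a d rr ss := by
    intro c hc
    obtain ⟨Φ, hΦ⟩ := exists_vermaHom hoff hsym hc
    have hone : ∀ x, Φ (freeToUpos a d x : Uq a d) (Submodule.Quotient.mk 1) =
        Submodule.Quotient.mk x := by
      intro x
      refine FreeAlgebra.mem_of_ι_mul_mem (LinearMap.eqLocus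
        (LinearMap.applyₗ (Submodule.Quotient.mk 1) ∘ₗ Φ.toLinearMap ∘ₗ
          (Upos a d).val.toLinearMap ∘ₗ (freeToUpos a d).toLinearMap)
        (Submodule.mkQ _)) ?_ (fun k z hz => ?_) x
      · simp [LinearMap.mem_eqLocus]
      · simp only [LinearMap.mem_eqLocus, LinearMap.coe_comp, Function.comp_apply,
          AlgHom.toLinearMap_apply, LinearMap.applyₗ_apply_apply, Submodule.mkQ_apply] at hz ⊢
        rw [freeToUpos_ι_mul, map_mul, map_mul, Module.End.mul_apply, hz]
        exact hΦ (Gen.e k) z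
    have h' := LinearMap.congr_fun (congrArg Φ h) (Submodule.Quotient.mk 1)
    rw [map_mul, map_mul, Module.End.mul_apply, Module.End.mul_apply, hone, hone, hΦ, hΦ,
      Submodule.Quotient.eq] at h'
    exact h'
  have h1 := key 1 one_ne_zero
  have h2 := Submodule.sub_mem _ (key 2 two_ne_zero) h1
  have hx : scaleHom (wt a d rr ss i) x ∈ serreIdeal a d rr ss := by
    have e : (2 : K2) - 1 = 1 := by norm_num
    rwa [sub_sub_sub_cancel_right, ← sub_smul, e, one_smul] at h2
  have hy : scaleHom (fun k => (wt a d rr ss k i)⁻¹) y ∈ serreIdeal a d rr ss := by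
    have := Submodule.sub_mem _ hx h1
    rwa [one_smul, sub_sub_cancel] at this
  constructor
  · have := scaleHom_mem_serreIdeal (wt a d rr ss i)⁻¹ hx
    rw [scaleHom_inv_scaleHom (hp i)] at this
    exact freeToUpos_eq_zero this
  · have := scaleHom_mem_serreIdeal (fun k => wt a d rr ss k i) hy
    rw [show scaleHom (fun k => wt a d rr ss k i)
      (scaleHom (fun k => (wt a d rr ss k i)⁻¹) y) = y
      from scaleHom_scaleHom_inv (fun k => hp k i) y] at this
    exact freeToUpos_eq_zero this

/-- In a module over a ring, whose addition need not be known to have inverses. -/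
theorem eq_of_add_neg_one_smul_eq_zero {K M : Type} [Ring K] [AddCommMonoid M] [Module K M]
    {x y : M} (h : x + (-1 : K) • y = 0) : x = y := by
  have hy : (-1 : K) • y + y = 0 := by
    nth_rewrite 2 [← one_smul K y]
    rw [← add_smul, neg_add_cancel, zero_smul]
  rw [← add_zero x, ← hy, ← add_assoc, h, zero_add]

/-- The relation behind the skew Leibniz rules, in an arbitrary algebra. -/
theorem skewLeibniz_of_rels {K B : Type} [Field K] [Ring B] [Algebra K B] (κ : Prop) [Decidable κ]
    {δ p q : K} (hδ : δ ≠ 0) (hp : p ≠ 0) (hq : q ≠ 0) {e f w w' P X X' Y Y' : B}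
    (hw : w * e = p • (e * w)) (hw' : w' * e = q⁻¹ • (e * w'))
    (hef : e * f = f * e + if κ then δ⁻¹ • (w - w') else 0)
    (hP : δ • (P * f - f * P) = w * X - w' * X')
    (heP : δ • (e * P * f - f * (e * P)) = w * Y - w' * Y') :
    w * (Y + (-1 : K) • (p⁻¹ • (e * X) + if κ then P else 0)) =
      w' * (Y' + (-1 : K) • (q • (e * X') + if κ then P else 0)) := by
  have h1 : w * (p⁻¹ • (e * X)) = e * (w * X) := by
    rw [mul_smul_comm, ← mul_assoc, hw, smul_mul_assoc, smul_smul, inv_mul_cancel₀ hp, one_smul,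
      mul_assoc]
  have h2 : w' * (q • (e * X')) = e * (w' * X') := by
    rw [mul_smul_comm, ← mul_assoc, hw', smul_mul_assoc, smul_smul, mul_inv_cancel₀ hq, one_smul,
      mul_assoc]
  have h3 : w * Y - w' * Y' = e * (w * X) - e * (w' * X') +
      δ • ((e * f - f * e) * P) := by
    rw [← heP, ← mul_sub, ← hP, mul_smul_comm, ← smul_add]
    congr 1
    noncomm_ring
  rw [hef, add_sub_cancel_left] at h3
  rw [← sub_eq_zero, neg_one_smul, neg_one_smul, ← sub_eq_add_neg, ← sub_eq_add_neg, mul_sub,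
    mul_sub, sub_sub_sub_comm, h3, mul_add, mul_add, h1, h2]
  split_ifs
  · rw [smul_mul_assoc, smul_smul, mul_inv_cancel₀ hδ, one_smul]
    noncomm_ring
  · simp

theorem gU_w_mul_e (i j : Fin n) : gU a d (Gen.w i) * gU a d (Gen.e j) =
    wt a d rr ss i j • (gU a d (Gen.e j) * gU a d (Gen.w i)) := by
  have h := RingQuot.mkAlgHom_rel K2 (URel.we (a := a) (d := d) i j)
  rwa [map_smul, map_mul, map_mul] at h

theorem gU_w'_mul_e (i j : Fin n) : gU a d (Gen.w' i) * gU a d (Gen.e j) =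
    (wt a d rr ss j i)⁻¹ • (gU a d (Gen.e j) * gU a d (Gen.w' i)) := by
  have h := RingQuot.mkAlgHom_rel K2 (URel.w'e (a := a) (d := d) i j)
  rwa [map_smul, map_mul, map_mul, ← wt_inv] at h

theorem gU_e_mul_f (i j : Fin n) :
    gU a d (Gen.e i) * gU a d (Gen.f j) = gU a d (Gen.f j) * gU a d (Gen.e i) +
      if i = j then (rr ^ d j - ss ^ d j)⁻¹ • (gU a d (Gen.w j) - gU a d (Gen.w' j)) else 0 := by
  have h := RingQuot.mkAlgHom_rel K2 (URel.ef (a := a) (d := d) i j)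
  rw [map_sub, map_mul, map_mul, sub_eq_iff_eq_add'] at h
  refine h.trans (congrArg _ ?_)
  split_ifs with hij
  · rw [map_smul, map_sub, hij]
    rfl
  · rw [map_zero]

variable {D D' : Fin n → (↥(Upos a d) →ₗ[K2] ↥(Upos a d))}

/-- The skew derivations vanish at `1`. -/
theorem skewDer_one (hoff : ∀ i j, i ≠ j → a i j ≤ 0)
    (hsym : ∀ i j, d i * a i j = d j * a j i)
    (hD : ∀ (i : Fin n) (P : ↥(Upos a d)),
      (rr ^ d i - ss ^ d i) •
          ((P : Uq a d) * gU a d (Gen.f i) - gU a d (Gen.f i) * (P : Uq a d)) =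
        gU a d (Gen.w i) * (D i P : Uq a d) - gU a d (Gen.w' i) * (D' i P : Uq a d))
    (i : Fin n) : D i 1 = 0 ∧ D' i 1 = 0 := by
  refine eq_zero_of_w_mul_eq_w'_mul hoff hsym i _ _ (sub_eq_zero.mp ?_)
  rw [← hD, OneMemClass.coe_one, one_mul, mul_one]
  exact (congrArg _ (sub_self _)).trans (smul_zero _)

/-- The skew Leibniz rules for left multiplication by a generator. -/
theorem skewDer_e_mul (hoff : ∀ i j, i ≠ j → a i j ≤ 0)
    (hsym : ∀ i j, d i * a i j = d j * a j i) (hdpos : ∀ i, 0 < d i)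
    (hD : ∀ (i : Fin n) (P : ↥(Upos a d)),
      (rr ^ d i - ss ^ d i) •
          ((P : Uq a d) * gU a d (Gen.f i) - gU a d (Gen.f i) * (P : Uq a d)) =
        gU a d (Gen.w i) * (D i P : Uq a d) - gU a d (Gen.w' i) * (D' i P : Uq a d))
    (i k : Fin n) (P : ↥(Upos a d)) :
    D i (eUp a d k * P) =
        (wt a d rr ss i k)⁻¹ • (eUp a d k * D i P) + (if k = i then P else 0) ∧
      D' i (eUp a d k * P) =
        wt a d rr ss k i • (eUp a d k * D' i P) + (if k = i then P else 0) := by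
  have hp := wt_ne_zero (a := a) (d := d) rr_ne_zero ss_ne_zero
  have key := skewLeibniz_of_rels (B := Uq a d) (e := gU a d (Gen.e k))
    (f := gU a d (Gen.f i)) (P := P) (k = i) (rr_zpow_sub_ss_zpow_ne_zero (hdpos i)) (hp i k)
    (hp k i) (gU_w_mul_e i k) (gU_w'_mul_e i k) (gU_e_mul_f k i) (hD i P)
    (hD i (eUp a d k * P))
  have hcoe : ((if k = i then P else 0 : ↥(Upos a d)) : Uq a d) =
      if k = i then (P : Uq a d) else 0 := by split_ifs <;> rfl
  have h := eq_zero_of_w_mul_eq_w'_mul hoff hsym i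
    (D i (eUp a d k * P) +
      (-1 : K2) • ((wt a d rr ss i k)⁻¹ • (eUp a d k * D i P) + (if k = i then P else 0)))
    (D' i (eUp a d k * P) +
      (-1 : K2) • (wt a d rr ss k i • (eUp a d k * D' i P) + (if k = i then P else 0)))
    (by
      simp only [Subalgebra.coe_add, Subalgebra.coe_smul, Subalgebra.coe_mul, hcoe]
      exact key)
  exact ⟨eq_of_add_neg_one_smul_eq_zero h.1, eq_of_add_neg_one_smul_eq_zero h.2⟩

end QuantumGroup
set_option synthInstance.maxHeartbeats 1000000
set_option maxHeartbeats 1000000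

/-- **Lemma 4.2 (first relation).** `∂_i ∂_j' = r^{⟨α_j,α_i⟩} s^{-⟨α_i,α_j⟩} ∂_j' ∂_i`
as operators on `U⁺`. -/
theorem skew_derivatives_commute
    (n : ℕ) (a : Fin n → Fin n → ℤ) (d : Fin n → ℤ)
    (hdiag : ∀ i, a i i = 2) (hoff : ∀ i j, i ≠ j → a i j ≤ 0)
    (hsym : ∀ i j, d i * a i j = d j * a j i) (hdpos : ∀ i, 0 < d i)
    (hfin : Matrix.PosDef (Matrix.of fun i j : Fin n => ((d i * a i j : ℤ) : ℝ)))
    (D D' : Fin n → (↥(Upos a d) →ₗ[K2] ↥(Upos a d)))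
    (hD : ∀ (i : Fin n) (P : ↥(Upos a d)),
      (rr ^ d i - ss ^ d i) •
          ((P : Uq a d) * gU a d (Gen.f i) - gU a d (Gen.f i) * (P : Uq a d)) =
        gU a d (Gen.w i) * (D i P : Uq a d) - gU a d (Gen.w' i) * (D' i P : Uq a d)) :
    ∀ i j : Fin n,
      (D i) ∘ₗ (D' j) =
        (rr ^ eulB a d j i * (ss ^ eulB a d i j)⁻¹) • ((D' j) ∘ₗ (D i)) := by
  intro i j
  have hp := wt_ne_zero (a := a) (d := d) rr_ne_zero ss_ne_zero
  have h1 := skewDer_one hoff hsym hD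
  have hL := fun i k P => (skewDer_e_mul hoff hsym hdpos hD i k P).1
  have hL' := fun i k P => (skewDer_e_mul hoff hsym hdpos hD i k P).2
  change D i ∘ₗ D' j = wt a d rr ss i j • (D' j ∘ₗ D i)
  refine LinearMap.ext fun P => ?_
  obtain ⟨x, rfl⟩ := freeToUpos_surjective P
  refine FreeAlgebra.mem_of_ι_mul_mem (LinearMap.eqLocus
    ((D i ∘ₗ D' j) ∘ₗ (freeToUpos a d).toLinearMap)
    ((wt a d rr ss i j • (D' j ∘ₗ D i)) ∘ₗ (freeToUpos a d).toLinearMap)) ?_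
    (fun k y hy => ?_) x
  · simp [LinearMap.mem_eqLocus, h1]
  · simp only [LinearMap.mem_eqLocus, LinearMap.coe_comp, Function.comp_apply,
      AlgHom.toLinearMap_apply, LinearMap.smul_apply] at hy ⊢
    rw [freeToUpos_ι_mul]
    generalize freeToUpos a d y = Q at hy ⊢
    rw [hL', hL, map_add, map_add, map_smul, map_smul, hL, hL', hy]
    have hi : D i (if k = j then Q else 0) = if k = j then D i Q else 0 := by
      split_ifs <;> simp
    have hj : D' j (if k = i then Q else 0) = if k = i then D' j Q else 0 := by
      split_ifs <;> simp
    have hj' : wt a d rr ss i j • (wt a d rr ss i k)⁻¹ • (if k = j then D i Q else 0) =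
        if k = j then D i Q else 0 := by
      split_ifs with h
      · rw [h, smul_smul, mul_inv_cancel₀ (hp i j), one_smul]
      · simp
    have hi' : wt a d rr ss k j • (if k = i then D' j Q else 0) =
        wt a d rr ss i j • (if k = i then D' j Q else 0) := by
      split_ifs with h
      · rw [h]
      · simp
    simp only [hi, hj, smul_add, hj', hi', mul_smul_comm]
    rw [smul_comm (wt a d rr ss k j), smul_comm (wt a d rr ss k j), smul_comm (wt a d rr ss i j)
      (wt a d rr ss i k)⁻¹]
    abel

end
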